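/- arXiv:math/0607124 — 3 statements merged into one kernel-verified Lean document; each statement's English description precedes it below -/
import Mathlib

section
/- Consider the move-to-front scheme on n cards with card probabilities p_1 ≥ p_2 ≥ ⋯ ≥ p_n, where each p_j > 0 and ∑_j p_j = 1, started from any fixed state s_0, and let π be its stationary distribution. Then for every t ≥ 0 the total variation distance satisfies ‖P(X_t ∈ ·) − π‖ ≤ ∑_{k=1}^{n−1} (1 − p_k)^t. -/
open Finset

/-- Total variation distance between two distributions on a finite set. -/
noncomputable def tvDist {S : Type*} [Fintype S] (μ ν : S → ℝ) : ℝ :=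
  (1/2) * ∑ s, |μ s - ν s|

/-- Point mass at `s0`. -/
noncomputable def dirac {S : Type*} [DecidableEq S] (s0 : S) : S → ℝ :=
  fun s => if s = s0 then 1 else 0

/-- Distribution of the chain with transition matrix `P` after `t` steps, started from `μ`. -/
noncomputable def evolve {S : Type*} [Fintype S] (P : S → S → ℝ) (μ : S → ℝ) : ℕ → S → ℝ
  | 0 => μ
  | t+1 => fun s' => ∑ s, evolve P μ t s * P s s'

/-- Mixing time: the worst case over starting states of the first time the
total variation distance to `π` drops to `1/4`. -/
noncomputable def mixTime {S : Type*} [Fintype S] [DecidableEq S]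
    (P : S → S → ℝ) (π : S → ℝ) : ℕ :=
  Finset.univ.sup fun s0 => sInf {t : ℕ | tvDist (evolve P (dirac s0) t) π ≤ 1/4}

/-- Transition matrix of the move-to-front scheme on `n` cards with card
probabilities `p`.  A state `σ` records the position `σ c` (with `0` the top) of
each card `c`; moving card `j` to the top turns `σ` into `Fin.cycleRange (σ j) * σ`. -/
noncomputable def mtfP (n : ℕ) (p : Fin n → ℝ) (σ σ' : Equiv.Perm (Fin n)) : ℝ :=
  ∑ j, if Fin.cycleRange (σ j) * σ = σ' then p j else 0

/-- Moving card `j` to the top of the deck `σ`. -/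
def moveToFront {n : ℕ} (j : Fin n) (σ : Equiv.Perm (Fin n)) : Equiv.Perm (Fin n) :=
  Fin.cycleRange (σ j) * σ

/-- The deck obtained from `σ` by moving to the front the cards of a list, the head of the
list being moved last. -/
def moveList {n : ℕ} : List (Fin n) → Equiv.Perm (Fin n) → Equiv.Perm (Fin n)
  | [], σ => σ
  | j :: l, σ => moveToFront j (moveList l σ)

theorem cycleRange_lt_cycleRange_iff {n : ℕ} {i x y : Fin n} (hx : x ≠ i) (hy : y ≠ i) :
    Fin.cycleRange i x < Fin.cycleRange i y ↔ x < y := by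
  rcases lt_or_gt_of_ne hx with h | h <;> rcases lt_or_gt_of_ne hy with h' | h'
  · rw [Fin.lt_def, Fin.coe_cycleRange_of_lt h, Fin.coe_cycleRange_of_lt h', Fin.lt_def]
    omega
  · rw [Fin.lt_def, Fin.coe_cycleRange_of_lt h, Fin.cycleRange_of_gt h', Fin.lt_def]
    omega
  · rw [Fin.lt_def, Fin.coe_cycleRange_of_lt h', Fin.cycleRange_of_gt h, Fin.lt_def]
    omega
  · rw [Fin.cycleRange_of_gt h, Fin.cycleRange_of_gt h']

theorem val_moveToFront_self {n : ℕ} (j : Fin n) (σ : Equiv.Perm (Fin n)) :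
    (moveToFront j σ j : ℕ) = 0 := by
  have : NeZero n := ⟨fun h => by subst h; exact j.elim0⟩
  simp [moveToFront]

theorem moveToFront_lt_iff_of_ne {n : ℕ} {j a b : Fin n} (σ : Equiv.Perm (Fin n))
    (ha : a ≠ j) (hb : b ≠ j) : moveToFront j σ a < moveToFront j σ b ↔ σ a < σ b :=
  cycleRange_lt_cycleRange_iff (σ.injective.ne ha) (σ.injective.ne hb)

theorem moveToFront_self_lt_iff {n : ℕ} (j b : Fin n) (σ : Equiv.Perm (Fin n)) :
    moveToFront j σ j < moveToFront j σ b ↔ b ≠ j := by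
  constructor
  · rintro h rfl
    exact lt_irrefl _ h
  · intro h
    have hne : (moveToFront j σ b : ℕ) ≠ moveToFront j σ j :=
      Fin.val_injective.ne ((moveToFront j σ).injective.ne h)
    rw [Fin.lt_def]
    rw [val_moveToFront_self] at hne ⊢
    omega

theorem not_moveToFront_lt_self {n : ℕ} (j a : Fin n) (σ : Equiv.Perm (Fin n)) :
    ¬ moveToFront j σ a < moveToFront j σ j := by
  rw [Fin.lt_def, val_moveToFront_self]
  omega

/-- The relative order of two cards is forgotten once one of them has been moved. -/
theorem moveList_lt_iff {n : ℕ} (σ τ : Equiv.Perm (Fin n)) {l : List (Fin n)} {a b : Fin n}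
    (h : a ∈ l ∨ b ∈ l) :
    moveList l σ a < moveList l σ b ↔ moveList l τ a < moveList l τ b := by
  induction l with
  | nil => simp at h
  | cons j l ih =>
    simp only [moveList]
    by_cases ha : a = j
    · subst ha
      simp only [moveToFront_self_lt_iff]
    by_cases hb : b = j
    · subst hb
      simp only [not_moveToFront_lt_self]
    rw [moveToFront_lt_iff_of_ne _ ha hb, moveToFront_lt_iff_of_ne _ ha hb]
    exact ih (by simpa [ha, hb] using h)

theorem perm_eq_of_lt_iff {n : ℕ} {σ τ : Equiv.Perm (Fin n)}
    (h : ∀ a b, σ a < σ b ↔ τ a < τ b) : σ = τ := by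
  have hmono : StrictMono (τ ∘ σ.symm) := fun x y hxy =>
    (h _ _).1 (by simpa using hxy)
  have hid := StrictMono.range_inj hmono strictMono_id |>.1
    (by rw [(τ.surjective.comp σ.symm.surjective).range_eq, Set.range_id])
  ext a
  simpa using congrArg Fin.val (congrFun hid (σ a)).symm

/-- Once every card but the last one has been moved, the deck has forgotten where it started. -/
theorem moveList_eq_moveList {n : ℕ} (σ τ : Equiv.Perm (Fin n)) {l : List (Fin n)}
    (h : ∀ j : Fin n, (j : ℕ) < n - 1 → j ∈ l) : moveList l σ = moveList l τ := by
  refine perm_eq_of_lt_iff fun a b => ?_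
  by_cases hab : a = b
  · simp [hab]
  refine moveList_lt_iff σ τ ?_
  by_cases ha : (a : ℕ) < n - 1
  · exact Or.inl (h a ha)
  · exact Or.inr (h b (by omega))

/-- Expectation of `f` over words of `t` independent letters with weights `p`. -/
noncomputable def wordSum {α : Type*} [Fintype α] (p : α → ℝ) (t : ℕ) (f : List α → ℝ) : ℝ :=
  ∑ w : Fin t → α, (∏ i, p (w i)) * f (List.ofFn w)

theorem wordSum_zero {α : Type*} [Fintype α] (p : α → ℝ) (f : List α → ℝ) :
    wordSum p 0 f = f [] := by
  simp [wordSum]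

theorem wordSum_succ {α : Type*} [Fintype α] (p : α → ℝ) (t : ℕ) (f : List α → ℝ) :
    wordSum p (t + 1) f = ∑ j, p j * wordSum p t (fun l => f (j :: l)) := by
  unfold wordSum
  rw [← (Fin.consEquiv (fun _ => α)).sum_comp, Fintype.sum_prod_type]
  refine Finset.sum_congr rfl fun j _ => ?_
  rw [Finset.mul_sum]
  refine Finset.sum_congr rfl fun w _ => ?_
  simp [Fin.consEquiv, Fin.prod_univ_succ, List.ofFn_succ, mul_assoc]

theorem wordSum_mono {α : Type*} [Fintype α] {p : α → ℝ} (hp : ∀ j, 0 ≤ p j) (t : ℕ)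
    {f g : List α → ℝ} (h : ∀ l, f l ≤ g l) : wordSum p t f ≤ wordSum p t g :=
  Finset.sum_le_sum fun _ _ =>
    mul_le_mul_of_nonneg_left (h _) (Finset.prod_nonneg fun _ _ => hp _)

theorem abs_wordSum_le {α : Type*} [Fintype α] {p : α → ℝ} (hp : ∀ j, 0 ≤ p j) (t : ℕ)
    (f : List α → ℝ) : |wordSum p t f| ≤ wordSum p t (fun l => |f l|) := by
  refine (Finset.abs_sum_le_sum_abs _ _).trans_eq (Finset.sum_congr rfl fun w _ => ?_)
  rw [abs_mul, abs_of_nonneg (Finset.prod_nonneg fun _ _ => hp _)]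

theorem wordSum_sub {α : Type*} [Fintype α] (p : α → ℝ) (t : ℕ) (f g : List α → ℝ) :
    wordSum p t (fun l => f l - g l) = wordSum p t f - wordSum p t g := by
  simp [wordSum, mul_sub]

theorem wordSum_finset_sum {α ι : Type*} [Fintype α] (p : α → ℝ) (t : ℕ) (s : Finset ι)
    (f : ι → List α → ℝ) :
    wordSum p t (fun l => ∑ i ∈ s, f i l) = ∑ i ∈ s, wordSum p t (f i) := by
  simp only [wordSum, Finset.mul_sum]
  exact Finset.sum_comm

theorem wordSum_const_mul {α : Type*} [Fintype α] (p : α → ℝ) (t : ℕ) (c : ℝ)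
    (f : List α → ℝ) : wordSum p t (fun l => c * f l) = c * wordSum p t f := by
  simp only [wordSum, Finset.mul_sum]
  exact Finset.sum_congr rfl fun _ _ => by ring

/-- The probability that a given letter is missing from a random word of length `t`. -/
theorem wordSum_notMem {α : Type*} [Fintype α] [DecidableEq α] {p : α → ℝ}
    (hsum : ∑ j, p j = 1) (k : α) (t : ℕ) :
    wordSum p t (fun l => if k ∉ l then 1 else 0) = (1 - p k) ^ t := by
  induction t with
  | zero => simp [wordSum_zero]
  | succ t ih =>
    have hj : ∀ j, p j * wordSum p t (fun l => if k ∉ j :: l then 1 else 0) =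
        (if j = k then 0 else p j) * (1 - p k) ^ t := by
      intro j
      by_cases hjk : j = k
      · simp [hjk, wordSum]
      · simp only [List.mem_cons, Ne.symm hjk, false_or, hjk, if_false, ih]
    have hk : ∑ j, (if j = k then 0 else p j) = 1 - p k := by
      have hj' : ∀ j, (if j = k then 0 else p j) = p j - if j = k then p j else 0 := fun j => by
        split_ifs <;> simp
      simp [hj', Finset.sum_sub_distrib, hsum]
    rw [wordSum_succ, Finset.sum_congr rfl fun j _ => hj j, ← Finset.sum_mul, hk, pow_succ']

theorem sum_mul_mtfP {n : ℕ} (p : Fin n → ℝ) (σ : Equiv.Perm (Fin n))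
    (f : Equiv.Perm (Fin n) → ℝ) :
    ∑ σ', mtfP n p σ σ' * f σ' = ∑ j, p j * f (moveToFront j σ) := by
  simp only [mtfP, Finset.sum_mul]
  rw [Finset.sum_comm]
  refine Finset.sum_congr rfl fun j _ => ?_
  simp [moveToFront, ite_mul]

theorem sum_evolve_mul {n : ℕ} (p : Fin n → ℝ) (μ : Equiv.Perm (Fin n) → ℝ) (t : ℕ)
    (f : Equiv.Perm (Fin n) → ℝ) :
    ∑ σ, evolve (mtfP n p) μ t σ * f σ =
      ∑ s, μ s * wordSum p t (fun l => f (moveList l s)) := by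
  induction t generalizing f with
  | zero => simp [wordSum_zero, evolve, moveList]
  | succ t ih =>
    calc ∑ σ, evolve (mtfP n p) μ (t + 1) σ * f σ
        = ∑ s, evolve (mtfP n p) μ t s * ∑ σ, mtfP n p s σ * f σ := by
          simp only [evolve, Finset.sum_mul, Finset.mul_sum, mul_assoc]
          exact Finset.sum_comm
      _ = ∑ j, p j * ∑ s, evolve (mtfP n p) μ t s * f (moveToFront j s) := by
          simp only [sum_mul_mtfP, Finset.mul_sum]
          rw [Finset.sum_comm]
          exact Finset.sum_congr rfl fun _ _ => Finset.sum_congr rfl fun _ _ => by ring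
      _ = _ := by
          simp only [ih, wordSum_succ, moveList, Finset.mul_sum]
          rw [Finset.sum_comm]
          exact Finset.sum_congr rfl fun _ _ => Finset.sum_congr rfl fun _ _ => by ring

theorem evolve_mtfP_apply {n : ℕ} (p : Fin n → ℝ) (μ : Equiv.Perm (Fin n) → ℝ) (t : ℕ)
    (σ : Equiv.Perm (Fin n)) :
    evolve (mtfP n p) μ t σ =
      ∑ s, μ s * wordSum p t (fun l => dirac (moveList l s) σ) := by
  have h := sum_evolve_mul p μ t (fun s => dirac s σ)
  simpa [dirac] using h

theorem evolve_stationary {S : Type*} [Fintype S] {P : S → S → ℝ} {π : S → ℝ}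
    (h : ∀ s', ∑ s, π s * P s s' = π s') (t : ℕ) : evolve P π t = π := by
  induction t with
  | zero => rfl
  | succ t ih => funext s'; simp only [evolve, ih, h]

theorem sum_abs_dirac_sub_dirac_le {S : Type*} [Fintype S] [DecidableEq S] (a b : S) :
    ∑ s, |dirac a s - dirac b s| ≤ if a = b then 0 else 2 := by
  split_ifs with h
  · simp [h]
  · calc ∑ s, |dirac a s - dirac b s| ≤ ∑ s, (|dirac a s| + |dirac b s|) :=
          Finset.sum_le_sum fun s _ => abs_sub _ _
      _ = 2 := by
          have habs : ∀ a s : S, |dirac a s| = if s = a then 1 else 0 := fun a s => by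
            unfold dirac; split_ifs <;> simp
          simp only [habs, Finset.sum_add_distrib, Finset.sum_ite_eq', Finset.mem_univ, if_true]
          norm_num

theorem sum_abs_dirac_moveList_le {n : ℕ} (l : List (Fin n)) (σ τ : Equiv.Perm (Fin n)) :
    ∑ s, |dirac (moveList l σ) s - dirac (moveList l τ) s| ≤
      2 * ∑ j ∈ Finset.univ.filter (fun j : Fin n => (j : ℕ) < n - 1),
        if j ∉ l then (1 : ℝ) else 0 := by
  have hnn : ∀ j ∈ Finset.univ.filter (fun j : Fin n => (j : ℕ) < n - 1),
      (0 : ℝ) ≤ if j ∉ l then (1 : ℝ) else 0 := fun j _ => by split_ifs <;> norm_num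
  refine (sum_abs_dirac_sub_dirac_le _ _).trans ?_
  split_ifs with h
  · exact mul_nonneg zero_le_two (Finset.sum_nonneg hnn)
  · obtain ⟨j, hj, hjl⟩ : ∃ j : Fin n, (j : ℕ) < n - 1 ∧ j ∉ l := by
      by_contra! hc
      exact h (moveList_eq_moveList σ τ hc)
    have := Finset.single_le_sum hnn (Finset.mem_filter.2 ⟨Finset.mem_univ j, hj⟩)
    rw [if_pos hjl] at this
    linarith

/-- Coupon-collector upper bound on the distance to stationarity for the
move-to-front scheme: `‖P(X_t ∈ ·) − π‖ ≤ ∑_{k=1}^{n−1} (1 − p_k)^t`. -/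
theorem mtf_coupon_collector_bound (n : ℕ) (p : Fin n → ℝ)
    (hpos : ∀ j, 0 < p j) (hsum : ∑ j, p j = 1)
    (hmono : ∀ i j : Fin n, i ≤ j → p j ≤ p i)
    (π : Equiv.Perm (Fin n) → ℝ)
    (hπ0 : ∀ s, 0 ≤ π s) (hπ1 : ∑ s, π s = 1)
    (hstat : ∀ s', ∑ s, π s * mtfP n p s s' = π s')
    (s0 : Equiv.Perm (Fin n)) (t : ℕ) :
    tvDist (evolve (mtfP n p) (dirac s0) t) π ≤
      ∑ j ∈ Finset.univ.filter (fun j : Fin n => (j : ℕ) < n - 1), (1 - p j) ^ t := by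
  have hp : ∀ j, 0 ≤ p j := fun j => (hpos j).le
  set A := ∑ j ∈ Finset.univ.filter (fun j : Fin n => (j : ℕ) < n - 1), (1 - p j) ^ t with hA
  have hdiff : ∀ σ, evolve (mtfP n p) (dirac s0) t σ - π σ =
      ∑ s, π s * wordSum p t
        (fun l => dirac (moveList l s0) σ - dirac (moveList l s) σ) := by
    intro σ
    have h0 : evolve (mtfP n p) (dirac s0) t σ =
        wordSum p t (fun l => dirac (moveList l s0) σ) := by
      rw [evolve_mtfP_apply, Finset.sum_eq_single s0 _ (by simp)]
      · simp [dirac]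
      · intro s _ hs
        simp [dirac, hs]
    have h1 : π σ = ∑ s, π s * wordSum p t (fun l => dirac (moveList l s) σ) := by
      rw [← evolve_mtfP_apply, evolve_stationary hstat]
    rw [h0]
    conv_lhs => rw [h1]
    simp only [wordSum_sub, mul_sub, Finset.sum_sub_distrib]
    rw [← Finset.sum_mul, hπ1, one_mul]
  have hword : ∀ s, ∑ σ, wordSum p t
      (fun l => |dirac (moveList l s0) σ - dirac (moveList l s) σ|) ≤ 2 * A := by
    intro s
    rw [← wordSum_finset_sum]
    refine (wordSum_mono hp t fun l => sum_abs_dirac_moveList_le l s0 s).trans_eq ?_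
    rw [wordSum_const_mul, wordSum_finset_sum]
    simp only [wordSum_notMem hsum, hA]
  have hsum_le : ∑ σ, |evolve (mtfP n p) (dirac s0) t σ - π σ| ≤ 2 * A := by
    calc ∑ σ, |evolve (mtfP n p) (dirac s0) t σ - π σ|
        ≤ ∑ σ, ∑ s, π s * wordSum p t
            (fun l => |dirac (moveList l s0) σ - dirac (moveList l s) σ|) := by
          refine Finset.sum_le_sum fun σ _ => ?_
          rw [hdiff]
          refine (Finset.abs_sum_le_sum_abs _ _).trans (Finset.sum_le_sum fun s _ => ?_)
          rw [abs_mul, abs_of_nonneg (hπ0 s)]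
          exact mul_le_mul_of_nonneg_left (abs_wordSum_le hp t _) (hπ0 s)
      _ = ∑ s, π s * ∑ σ, wordSum p t
            (fun l => |dirac (moveList l s0) σ - dirac (moveList l s) σ|) := by
          rw [Finset.sum_comm]
          simp only [Finset.mul_sum]
      _ ≤ ∑ s, π s * (2 * A) :=
          Finset.sum_le_sum fun s _ => mul_le_mul_of_nonneg_left (hword s) (hπ0 s)
      _ = 2 * A := by rw [← Finset.sum_mul, hπ1, one_mul]
  unfold tvDist
  linarith
end

section
/- Consider the move-to-front scheme on n cards (n even) with card probabilities p_1,…,p_n (each p_j > 0, ∑_j p_j = 1), started from the state s_0 in which card n is in position 1, card n−1 in position 2, …, card 1 in position n. For 1 ≤ j ≤ n−1 set γ_j := p_j + p_{j+1} and define Φ_j(σ) = p_j/γ_j if card j+1 lies above card j in σ and Φ_j(σ) = −p_{j+1}/γ_j otherwise. Then for all distinct odd j, k and every t ≥ 0: E[Φ_j(X_t)] = (1 − γ_j)^t p_j/γ_j, E[Φ_j(X_t) Φ_k(X_t)] = (1 − γ_j − γ_k)^t p_j p_k/(γ_j γ_k), and consequently Cov(Φ_j(X_t), Φ_k(X_t))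 = ((1 − γ_j − γ_k)^t − (1 − γ_j)^t (1 − γ_k)^t) p_j p_k/(γ_j γ_k) ≤ 0. -/
open Finset

/-- The test function `Φ_j` of Section 3.2: it takes the value `p_j/(p_j+p_{j+1})`
when card `j+1` lies above card `j` (its position is at most that of card `j`),
and `−p_{j+1}/(p_j+p_{j+1})` otherwise. -/
noncomputable def mtfPhi (n : ℕ) (p : Fin n → ℝ) (j : Fin n) (hj : (j : ℕ) + 1 < n)
    (σ : Equiv.Perm (Fin n)) : ℝ :=
  if σ ⟨(j : ℕ) + 1, hj⟩ ≤ σ j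
    then p j / (p j + p ⟨(j : ℕ) + 1, hj⟩)
    else -(p ⟨(j : ℕ) + 1, hj⟩ / (p j + p ⟨(j : ℕ) + 1, hj⟩))

/-- Expectation of `f` at time `t` for the move-to-front chain started from the
reversed deck `Fin.revPerm` (card `n` on top, …, card `1` at the bottom). -/
noncomputable def mtfExp (n : ℕ) (p : Fin n → ℝ) (t : ℕ)
    (f : Equiv.Perm (Fin n) → ℝ) : ℝ :=
  ∑ σ, evolve (mtfP n p) (dirac (Fin.revPerm : Equiv.Perm (Fin n))) t σ * f σ

/-- Moving a card to the top does not change the relative order of two other cards. -/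
lemma cycleRange_le_cycleRange_iff {n : ℕ} {i x y : Fin n} (hx : x ≠ i) (hy : y ≠ i) :
    Fin.cycleRange i x ≤ Fin.cycleRange i y ↔ x ≤ y := by
  have hval : ∀ z : Fin n, z ≠ i →
      (Fin.cycleRange i z : ℕ) = if (z : ℕ) < i then (z : ℕ) + 1 else z := by
    intro z hz
    rcases lt_or_gt_of_ne hz with h | h
    · rw [Fin.coe_cycleRange_of_lt h, if_pos (Fin.lt_def.mp h)]
    · rw [Fin.cycleRange_of_gt h, if_neg (not_lt.mpr (Fin.lt_def.mp h).le)]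
  have hx' : (x : ℕ) ≠ i := fun h => hx (Fin.ext h)
  have hy' : (y : ℕ) ≠ i := fun h => hy (Fin.ext h)
  rw [Fin.le_def, Fin.le_def, hval x hx, hval y hy]
  split_ifs <;> omega

/-- A card moved to the top does not lie below any other card. -/
lemma cycleRange_self_lt {n : ℕ} {i x : Fin n} (hx : x ≠ i) :
    Fin.cycleRange i i < Fin.cycleRange i x := by
  have : NeZero n := ⟨(Fin.pos i).ne'⟩
  have h0 : Fin.cycleRange i i = 0 := Fin.cycleRange_self i
  rw [h0]
  refine Fin.pos_iff_ne_zero.mpr fun h => hx ?_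
  exact (Fin.cycleRange i).injective (h.trans h0.symm)

/-- One step of the chain acts on expectations through the transition operator. -/
lemma mtfExp_succ (n : ℕ) (p : Fin n → ℝ) (t : ℕ) (f : Equiv.Perm (Fin n) → ℝ) :
    mtfExp n p (t + 1) f
      = mtfExp n p t (fun σ => ∑ c, p c * f (Fin.cycleRange (σ c) * σ)) := by
  have hstep : ∀ σ, ∑ σ', mtfP n p σ σ' * f σ'
      = ∑ c, p c * f (Fin.cycleRange (σ c) * σ) := by
    intro σ
    simp only [mtfP, Finset.sum_mul, ite_mul, zero_mul]
    rw [Finset.sum_comm]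
    simp
  simp only [mtfExp, evolve, ← hstep, Finset.sum_mul, Finset.mul_sum]
  rw [Finset.sum_comm]
  simp only [mul_assoc]

/-- Expectations of an eigenfunction of the transition operator decay geometrically. -/
lemma mtfExp_eq_of_eigenfunction (n : ℕ) (p : Fin n → ℝ) (r : ℝ)
    (f : Equiv.Perm (Fin n) → ℝ)
    (hf : ∀ σ, ∑ c, p c * f (Fin.cycleRange (σ c) * σ) = r * f σ) (t : ℕ) :
    mtfExp n p t f = r ^ t * f Fin.revPerm := by
  induction t with
  | zero => simp [mtfExp, evolve, dirac]
  | succ t ih =>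
    have hlin : mtfExp n p t (fun σ => r * f σ) = r * mtfExp n p t f := by
      simp only [mtfExp, Finset.mul_sum]
      exact Finset.sum_congr rfl fun _ _ => by ring
    rw [mtfExp_succ]
    simp only [hf]
    rw [hlin, ih]
    ring

/-- `Φ_j` is unaffected by moving a card other than `j` and `j + 1`. -/
lemma mtfPhi_move_of_ne {n : ℕ} (p : Fin n → ℝ) {j : Fin n} (hj : (j : ℕ) + 1 < n)
    {c : Fin n} (h : c ≠ j) (h' : c ≠ ⟨(j : ℕ) + 1, hj⟩) (σ : Equiv.Perm (Fin n)) :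
    mtfPhi n p j hj (Fin.cycleRange (σ c) * σ) = mtfPhi n p j hj σ := by
  simp only [mtfPhi, Equiv.Perm.mul_apply,
    cycleRange_le_cycleRange_iff (σ.injective.ne h'.symm) (σ.injective.ne h.symm)]

/-- The increments of `Φ_j` under one step of the chain. -/
lemma sum_mul_mtfPhi_move_sub {n : ℕ} (p : Fin n → ℝ)
    {j : Fin n} (hj : (j : ℕ) + 1 < n) (σ : Equiv.Perm (Fin n)) :
    ∑ c, p c * (mtfPhi n p j hj (Fin.cycleRange (σ c) * σ) - mtfPhi n p j hj σ)
      = -(p j + p ⟨(j : ℕ) + 1, hj⟩) * mtfPhi n p j hj σ := by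
  have hne : j ≠ ⟨(j : ℕ) + 1, hj⟩ := fun h => by
    have := congrArg Fin.val h
    simp at this
  have h1 : mtfPhi n p j hj (Fin.cycleRange (σ j) * σ)
      = -(p ⟨(j : ℕ) + 1, hj⟩ / (p j + p ⟨(j : ℕ) + 1, hj⟩)) := by
    rw [mtfPhi, if_neg]
    exact not_le.mpr (cycleRange_self_lt (σ.injective.ne hne.symm))
  have h2 : mtfPhi n p j hj (Fin.cycleRange (σ ⟨(j : ℕ) + 1, hj⟩) * σ)
      = p j / (p j + p ⟨(j : ℕ) + 1, hj⟩) := by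
    rw [mtfPhi, if_pos]
    exact (cycleRange_self_lt (σ.injective.ne hne)).le
  rw [← Finset.sum_subset (Finset.subset_univ {j, ⟨(j : ℕ) + 1, hj⟩}), Finset.sum_pair hne,
    h1, h2]
  · ring
  · intro c _ hc
    simp only [Finset.mem_insert, Finset.mem_singleton, not_or] at hc
    rw [mtfPhi_move_of_ne p hj hc.1 hc.2, sub_self, mul_zero]

lemma mtfPhi_revPerm {n : ℕ} (p : Fin n → ℝ) {j : Fin n} (hj : (j : ℕ) + 1 < n) :
    mtfPhi n p j hj Fin.revPerm = p j / (p j + p ⟨(j : ℕ) + 1, hj⟩) := by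
  rw [mtfPhi, if_pos]
  simp only [Fin.revPerm_apply, Fin.le_def, Fin.val_rev]
  omega

lemma mtfExp_mtfPhi {n : ℕ} {p : Fin n → ℝ} (hsum : ∑ j, p j = 1)
    {j : Fin n} (hj : (j : ℕ) + 1 < n) (t : ℕ) :
    mtfExp n p t (mtfPhi n p j hj)
      = (1 - (p j + p ⟨(j : ℕ) + 1, hj⟩)) ^ t * (p j / (p j + p ⟨(j : ℕ) + 1, hj⟩)) := by
  rw [← mtfPhi_revPerm p hj]
  refine mtfExp_eq_of_eigenfunction n p _ _ (fun σ => ?_) t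
  have h := sum_mul_mtfPhi_move_sub p hj σ
  simp only [mul_sub, Finset.sum_sub_distrib, ← Finset.sum_mul, hsum] at h
  linarith

lemma mtfExp_mtfPhi_mul_mtfPhi {n : ℕ} {p : Fin n → ℝ}
    (hsum : ∑ j, p j = 1) {j k : Fin n} (hj : (j : ℕ) + 1 < n) (hk : (k : ℕ) + 1 < n)
    (hjk : j ≠ k) (hjk' : (j : ℕ) + 1 ≠ k) (hkj : (k : ℕ) + 1 ≠ j) (t : ℕ) :
    mtfExp n p t (fun σ => mtfPhi n p j hj σ * mtfPhi n p k hk σ)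
      = (1 - (p j + p ⟨(j : ℕ) + 1, hj⟩) - (p k + p ⟨(k : ℕ) + 1, hk⟩)) ^ t *
        (p j * p k / ((p j + p ⟨(j : ℕ) + 1, hj⟩) * (p k + p ⟨(k : ℕ) + 1, hk⟩))) := by
  rw [← div_mul_div_comm, ← mtfPhi_revPerm p hj, ← mtfPhi_revPerm p hk]
  refine mtfExp_eq_of_eigenfunction n p _
    (fun σ => mtfPhi n p j hj σ * mtfPhi n p k hk σ) (fun σ => ?_) t
  have hdecomp : ∀ c, p c * (mtfPhi n p j hj (Fin.cycleRange (σ c) * σ)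
        * mtfPhi n p k hk (Fin.cycleRange (σ c) * σ))
      = p c * (mtfPhi n p j hj σ * mtfPhi n p k hk σ)
        + p c * (mtfPhi n p j hj (Fin.cycleRange (σ c) * σ) - mtfPhi n p j hj σ)
          * mtfPhi n p k hk σ
        + p c * (mtfPhi n p k hk (Fin.cycleRange (σ c) * σ) - mtfPhi n p k hk σ)
          * mtfPhi n p j hj σ := by
    intro c
    by_cases hc : c ≠ j ∧ c ≠ ⟨(j : ℕ) + 1, hj⟩
    · rw [mtfPhi_move_of_ne p hj hc.1 hc.2]
      ring
    · have hck : c ≠ k ∧ c ≠ ⟨(k : ℕ) + 1, hk⟩ := by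
        simp only [ne_eq, Fin.ext_iff] at hc hjk ⊢
        omega
      rw [mtfPhi_move_of_ne p hk hck.1 hck.2]
      ring
  simp only [hdecomp, Finset.sum_add_distrib, ← Finset.sum_mul, hsum,
    sum_mul_mtfPhi_move_sub]
  ring

/-- Moment computations of Section 3.2: for distinct odd cards `j, k` (odd in the
paper's 1-based indexing, hence even as elements of `Fin n`), the means, mixed moments
and covariances of `Φ_j(X_t)`, `Φ_k(X_t)` are as computed there, and the covariance
is nonpositive.  The chain starts from the reversed deck `Fin.revPerm`. -/
theorem mtf_covariance (n : ℕ) (hn : Even n) (p : Fin n → ℝ)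
    (hpos : ∀ j, 0 < p j) (hsum : ∑ j, p j = 1)
    (j k : Fin n) (hj : (j : ℕ) + 1 < n) (hk : (k : ℕ) + 1 < n)
    (hjodd : Even (j : ℕ)) (hkodd : Even (k : ℕ)) (hjk : j ≠ k) (t : ℕ) :
    mtfExp n p t (mtfPhi n p j hj)
        = (1 - (p j + p ⟨(j : ℕ) + 1, hj⟩)) ^ t * (p j / (p j + p ⟨(j : ℕ) + 1, hj⟩)) ∧
    mtfExp n p t (fun σ => mtfPhi n p j hj σ * mtfPhi n p k hk σ)
        = (1 - (p j + p ⟨(j : ℕ) + 1, hj⟩) - (p k + p ⟨(k : ℕ) + 1, hk⟩)) ^ t *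
          (p j * p k / ((p j + p ⟨(j : ℕ) + 1, hj⟩) * (p k + p ⟨(k : ℕ) + 1, hk⟩))) ∧
    mtfExp n p t (fun σ => mtfPhi n p j hj σ * mtfPhi n p k hk σ)
        - mtfExp n p t (mtfPhi n p j hj) * mtfExp n p t (mtfPhi n p k hk)
      = ((1 - (p j + p ⟨(j : ℕ) + 1, hj⟩) - (p k + p ⟨(k : ℕ) + 1, hk⟩)) ^ t
          - (1 - (p j + p ⟨(j : ℕ) + 1, hj⟩)) ^ t * (1 - (p k + p ⟨(k : ℕ) + 1, hk⟩)) ^ t) *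
        (p j * p k / ((p j + p ⟨(j : ℕ) + 1, hj⟩) * (p k + p ⟨(k : ℕ) + 1, hk⟩))) ∧
    mtfExp n p t (fun σ => mtfPhi n p j hj σ * mtfPhi n p k hk σ)
        - mtfExp n p t (mtfPhi n p j hj) * mtfExp n p t (mtfPhi n p k hk) ≤ 0 := by
  have hjk_val : (j : ℕ) ≠ k := fun h => hjk (Fin.ext h)
  have hjk' : (j : ℕ) + 1 ≠ k := by
    obtain ⟨a, ha⟩ := hjodd
    obtain ⟨b, hb⟩ := hkodd
    omega
  have hkj : (k : ℕ) + 1 ≠ j := by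
    obtain ⟨a, ha⟩ := hjodd
    obtain ⟨b, hb⟩ := hkodd
    omega
  have hmul := mtfExp_mtfPhi_mul_mtfPhi hsum hj hk hjk hjk' hkj t
  have hcov : mtfExp n p t (fun σ => mtfPhi n p j hj σ * mtfPhi n p k hk σ)
        - mtfExp n p t (mtfPhi n p j hj) * mtfExp n p t (mtfPhi n p k hk)
      = ((1 - (p j + p ⟨(j : ℕ) + 1, hj⟩) - (p k + p ⟨(k : ℕ) + 1, hk⟩)) ^ t
          - (1 - (p j + p ⟨(j : ℕ) + 1, hj⟩)) ^ t * (1 - (p k + p ⟨(k : ℕ) + 1, hk⟩)) ^ t) *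
        (p j * p k / ((p j + p ⟨(j : ℕ) + 1, hj⟩) * (p k + p ⟨(k : ℕ) + 1, hk⟩))) := by
    rw [hmul, mtfExp_mtfPhi hsum hj t, mtfExp_mtfPhi hsum hk t, ← div_mul_div_comm]
    ring
  refine ⟨mtfExp_mtfPhi hsum hj t, hmul, hcov, ?_⟩
  have hle : p j + p ⟨(j : ℕ) + 1, hj⟩ + (p k + p ⟨(k : ℕ) + 1, hk⟩) ≤ 1 := by
    have hsub := Finset.sum_le_sum_of_subset_of_nonneg
      (Finset.subset_univ {j, ⟨(j : ℕ) + 1, hj⟩, k, ⟨(k : ℕ) + 1, hk⟩})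
      (fun c _ _ => (hpos c).le)
    rw [hsum, Finset.sum_insert, Finset.sum_insert, Finset.sum_pair] at hsub
    · linarith
    all_goals
      simp only [Finset.mem_insert, Finset.mem_singleton, ne_eq, Fin.ext_iff]
      omega
  have hγj := add_pos (hpos j) (hpos ⟨(j : ℕ) + 1, hj⟩)
  have hγk := add_pos (hpos k) (hpos ⟨(k : ℕ) + 1, hk⟩)
  have hpj := hpos j
  have hpk := hpos k
  rw [hcov]
  refine mul_nonpos_of_nonpos_of_nonneg (sub_nonpos.mpr ?_) (by positivity)
  rw [← mul_pow]
  exact pow_le_pow_left₀ (by linarith) (by nlinarith) t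
end

section
/- Let {X_t} be an irreducible aperiodic Markov chain on a finite state space S with transition matrix P and stationary distribution π, started at a fixed state s_0. Suppose Φ_1,…,Φ_m : S → ℝ and γ_1,…,γ_m ∈ (0, 1/2] satisfy, for each j: (i) ∑_{s'} P(s,s') Φ_j(s') = (1 − γ_j) Φ_j(s) for all s ∈ S; (ii) ∑_{s'} P(s,s') (Φ_j(s') − Φ_j(s))² ≤ γ_j for all s ∈ S; and (iii) Cov(Φ_j(X_t), Φ_k(X_t)) ≤ 0 for all j ≠ k and all t ≥ 0. Then for any real unit vector (a_1,…,a_m) with ∑_j a_j² = 1 and any t ≥ 0 such that |∑_{j=1}^m a_j (1 − γ_j)^t Φ_j(s_0)| ≥ √6, the total variation distance between the distribution of X_t and π is at least 1/3. -/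
open Finset

section Evolution

variable {S : Type*} [Fintype S]

theorem evolve_nonneg {P : S → S → ℝ} (hP0 : ∀ s s', 0 ≤ P s s') {μ : S → ℝ}
    (hμ : ∀ s, 0 ≤ μ s) (t : ℕ) (s : S) : 0 ≤ evolve P μ t s := by
  induction t generalizing s with
  | zero => exact hμ s
  | succ t ih => exact Finset.sum_nonneg fun s' _ => mul_nonneg (ih s') (hP0 s' s)

/-- Duality between one step of the chain and the transition operator on functions. -/
theorem sum_evolve_succ_mul (P : S → S → ℝ) (μ f : S → ℝ) (t : ℕ) :
    ∑ s, evolve P μ (t + 1) s * f s = ∑ s, evolve P μ t s * ∑ s', P s s' * f s' := by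
  simp only [evolve, Finset.sum_mul, Finset.mul_sum]
  rw [Finset.sum_comm]
  exact Finset.sum_congr rfl fun _ _ => Finset.sum_congr rfl fun _ _ => by ring

theorem sum_evolve {P : S → S → ℝ} (hP1 : ∀ s, ∑ s', P s s' = 1) {μ : S → ℝ}
    (hμ : ∑ s, μ s = 1) (t : ℕ) : ∑ s, evolve P μ t s = 1 := by
  induction t with
  | zero => exact hμ
  | succ t ih => simpa [hP1, ih] using sum_evolve_succ_mul P μ (fun _ => 1) t

/-- A stationary distribution is unchanged by the evolution. -/
theorem evolve_of_stationary {P : S → S → ℝ} {π : S → ℝ}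
    (hstat : ∀ s', ∑ s, π s * P s s' = π s') (t : ℕ) : evolve P π t = π := by
  induction t with
  | zero => rfl
  | succ t ih => funext s'; simp only [evolve, ih, hstat]

theorem sum_evolve_mul_eigenvector {P : S → S → ℝ} (μ : S → ℝ) {φ : S → ℝ} {c : ℝ}
    (heig : ∀ s, ∑ s', P s s' * φ s' = c * φ s) (t : ℕ) :
    ∑ s, evolve P μ t s * φ s = c ^ t * ∑ s, μ s * φ s := by
  induction t with
  | zero => simp [evolve]
  | succ t ih =>
    rw [sum_evolve_succ_mul, pow_succ', mul_assoc, ← ih, Finset.mul_sum]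
    exact Finset.sum_congr rfl fun s _ => by rw [heig]; ring

theorem sum_mul_sq_le_of_eigenvector {P : S → S → ℝ} (hP1 : ∀ s, ∑ s', P s s' = 1)
    {φ : S → ℝ} {γ : ℝ} (heig : ∀ s, ∑ s', P s s' * φ s' = (1 - γ) * φ s)
    (hvar : ∀ s, ∑ s', P s s' * (φ s' - φ s) ^ 2 ≤ γ) (s : S) :
    ∑ s', P s s' * φ s' ^ 2 ≤ (1 - 2 * γ) * φ s ^ 2 + γ := by
  have h : ∑ s', P s s' * (φ s' - φ s) ^ 2
      = ∑ s', P s s' * φ s' ^ 2 - 2 * φ s * ∑ s', P s s' * φ s' + φ s ^ 2 * ∑ s', P s s' := by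
    rw [Finset.mul_sum, Finset.mul_sum, ← Finset.sum_sub_distrib, ← Finset.sum_add_distrib]
    exact Finset.sum_congr rfl fun s' _ => by ring
  have h' := hvar s
  rw [h, heig, hP1] at h'
  linarith

theorem sum_evolve_succ_mul_sq_le {P : S → S → ℝ} (hP0 : ∀ s s', 0 ≤ P s s')
    (hP1 : ∀ s, ∑ s', P s s' = 1) {μ : S → ℝ} (hμ0 : ∀ s, 0 ≤ μ s) (hμ1 : ∑ s, μ s = 1)
    {φ : S → ℝ} {γ : ℝ} (heig : ∀ s, ∑ s', P s s' * φ s' = (1 - γ) * φ s)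
    (hvar : ∀ s, ∑ s', P s s' * (φ s' - φ s) ^ 2 ≤ γ) (t : ℕ) :
    ∑ s, evolve P μ (t + 1) s * φ s ^ 2
      ≤ (1 - 2 * γ) * ∑ s, evolve P μ t s * φ s ^ 2 + γ := by
  rw [sum_evolve_succ_mul]
  calc ∑ s, evolve P μ t s * ∑ s', P s s' * φ s' ^ 2
      ≤ ∑ s, evolve P μ t s * ((1 - 2 * γ) * φ s ^ 2 + γ) :=
        Finset.sum_le_sum fun s _ => mul_le_mul_of_nonneg_left
          (sum_mul_sq_le_of_eigenvector hP1 heig hvar s) (evolve_nonneg hP0 hμ0 t s)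
    _ = (1 - 2 * γ) * ∑ s, evolve P μ t s * φ s ^ 2 + γ * ∑ s, evolve P μ t s := by
        rw [Finset.mul_sum, Finset.mul_sum, ← Finset.sum_add_distrib]
        exact Finset.sum_congr rfl fun s _ => by ring
    _ = _ := by rw [sum_evolve hP1 hμ1, mul_one]

/-- The variance of an eigenfunction along the chain stays below `1/2`. -/
theorem variance_evolve_le_half {P : S → S → ℝ} (hP0 : ∀ s s', 0 ≤ P s s')
    (hP1 : ∀ s, ∑ s', P s s' = 1) {μ : S → ℝ} (hμ0 : ∀ s, 0 ≤ μ s) (hμ1 : ∑ s, μ s = 1)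
    {φ : S → ℝ} {γ : ℝ} (hγ : γ ≤ 1 / 2)
    (heig : ∀ s, ∑ s', P s s' * φ s' = (1 - γ) * φ s)
    (hvar : ∀ s, ∑ s', P s s' * (φ s' - φ s) ^ 2 ≤ γ)
    (hμ : ∑ s, μ s * φ s ^ 2 - (∑ s, μ s * φ s) ^ 2 ≤ 1 / 2) (t : ℕ) :
    ∑ s, evolve P μ t s * φ s ^ 2 - (∑ s, evolve P μ t s * φ s) ^ 2 ≤ 1 / 2 := by
  induction t with
  | zero => exact hμ
  | succ t ih =>
    have h1 := sum_evolve_succ_mul_sq_le hP0 hP1 hμ0 hμ1 heig hvar t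
    have h2 : ∑ s, evolve P μ (t + 1) s * φ s = (1 - γ) * ∑ s, evolve P μ t s * φ s := by
      rw [sum_evolve_mul_eigenvector μ heig, sum_evolve_mul_eigenvector μ heig]; ring
    rw [h2]
    nlinarith [mul_le_mul_of_nonneg_left ih (by linarith : 0 ≤ 1 - 2 * γ),
      sq_nonneg (γ * ∑ s, evolve P μ t s * φ s)]

theorem sum_stationary_mul {P : S → S → ℝ} {π : S → ℝ}
    (hstat : ∀ s', ∑ s, π s * P s s' = π s') (f : S → ℝ) :
    ∑ s, π s * ∑ s', P s s' * f s' = ∑ s, π s * f s := by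
  have h := sum_evolve_succ_mul P π f 0
  rw [evolve_of_stationary hstat, evolve_of_stationary hstat] at h
  exact h.symm

theorem sum_stationary_mul_eigenvector {P : S → S → ℝ} {π : S → ℝ}
    (hstat : ∀ s', ∑ s, π s * P s s' = π s') {φ : S → ℝ} {γ : ℝ} (hγ : γ ≠ 0)
    (heig : ∀ s, ∑ s', P s s' * φ s' = (1 - γ) * φ s) : ∑ s, π s * φ s = 0 := by
  have h := sum_evolve_mul_eigenvector π heig 1
  rw [evolve_of_stationary hstat, pow_one] at h
  have : γ * ∑ s, π s * φ s = 0 := by linarith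
  exact (mul_eq_zero.mp this).resolve_left hγ

theorem sum_stationary_mul_sq_le_half {P : S → S → ℝ} (hP0 : ∀ s s', 0 ≤ P s s')
    (hP1 : ∀ s, ∑ s', P s s' = 1) {π : S → ℝ} (hπ0 : ∀ s, 0 ≤ π s) (hπ1 : ∑ s, π s = 1)
    (hstat : ∀ s', ∑ s, π s * P s s' = π s') {φ : S → ℝ} {γ : ℝ} (hγ : 0 < γ)
    (heig : ∀ s, ∑ s', P s s' * φ s' = (1 - γ) * φ s)
    (hvar : ∀ s, ∑ s', P s s' * (φ s' - φ s) ^ 2 ≤ γ) : ∑ s, π s * φ s ^ 2 ≤ 1 / 2 := by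
  have h := sum_evolve_succ_mul_sq_le hP0 hP1 hπ0 hπ1 heig hvar 0
  rw [evolve_of_stationary hstat, evolve_of_stationary hstat] at h
  by_contra! h'
  nlinarith

theorem sum_dirac_mul [DecidableEq S] (s0 : S) (f : S → ℝ) :
    ∑ s, dirac s0 s * f s = f s0 := by
  simp [dirac]

theorem dirac_nonneg {S : Type*} [DecidableEq S] (s0 s : S) : 0 ≤ dirac s0 s := by
  unfold dirac; split_ifs <;> norm_num

theorem sum_dirac [DecidableEq S] (s0 : S) : ∑ s, dirac s0 s = 1 := by
  simp [dirac]

/-- Harmonic functions of an irreducible finite chain are constant. -/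
theorem harmonic_eq_of_irreducible [DecidableEq S] {P : S → S → ℝ}
    (hP0 : ∀ s s', 0 ≤ P s s') (hP1 : ∀ s, ∑ s', P s s' = 1)
    (hirr : ∀ s s', ∃ t : ℕ, 0 < evolve P (dirac s) t s') {h : S → ℝ}
    (hh : ∀ s, ∑ s', P s s' * h s' = h s) (s s' : S) : h s = h s' := by
  obtain ⟨x, -, hx⟩ := Finset.exists_max_image Finset.univ h ⟨s, Finset.mem_univ s⟩
  suffices H : ∀ y, h y = h x from (H s).trans (H s').symm
  intro y
  obtain ⟨t, ht⟩ := hirr x y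
  have h1 : ∑ s, evolve P (dirac x) t s * h s = h x := by
    rw [sum_evolve_mul_eigenvector (c := 1) _ (by simpa using hh), sum_dirac_mul]; simp
  have h2 : ∑ s, evolve P (dirac x) t s * (h x - h s) = 0 := by
    simp only [mul_sub, Finset.sum_sub_distrib, h1, ← Finset.sum_mul,
      sum_evolve hP1 (sum_dirac x)]
    ring
  have h3 := (Finset.sum_eq_zero_iff_of_nonneg fun s hs => mul_nonneg
    (evolve_nonneg hP0 (dirac_nonneg x) t s) (sub_nonneg.mpr (hx s hs))).mp h2 y
    (Finset.mem_univ y)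
  linarith [(mul_eq_zero.mp h3).resolve_left ht.ne']

/-- Solvability of the Poisson equation for an irreducible finite chain. -/
theorem exists_poisson_solution [DecidableEq S] {P : S → S → ℝ}
    (hP0 : ∀ s s', 0 ≤ P s s') (hP1 : ∀ s, ∑ s', P s s' = 1)
    (hirr : ∀ s s', ∃ t : ℕ, 0 < evolve P (dirac s) t s')
    {π : S → ℝ} (hπ1 : ∑ s, π s = 1) (hstat : ∀ s', ∑ s, π s * P s s' = π s')
    {g : S → ℝ} (hg : ∑ s, π s * g s = 0) :
    ∃ h : S → ℝ, ∀ s, h s - ∑ s', P s s' * h s' = g s := by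
  let L : (S → ℝ) →ₗ[ℝ] (S → ℝ) := LinearMap.id - Matrix.mulVecLin (Matrix.of P)
  have hL : ∀ h s, L h s = h s - ∑ s', P s s' * h s' := fun h s => by
    simp [L, Matrix.mulVec, dotProduct]
  let ℓ : (S → ℝ) →ₗ[ℝ] ℝ := ∑ s, π s • LinearMap.proj s
  have hℓ : ∀ f, ℓ f = ∑ s, π s * f s := fun f => by simp [ℓ]
  have hker : L.ker ≤ Submodule.span ℝ {fun _ => 1} := by
    intro h hh
    have hh' : ∀ s, ∑ s', P s s' * h s' = h s := fun s => by
      have := congrFun (LinearMap.mem_ker.mp hh) s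
      rw [hL, Pi.zero_apply] at this
      linarith
    rw [Submodule.mem_span_singleton]
    refine ⟨∑ s, π s * h s, funext fun s => ?_⟩
    have : ∀ s', h s' = h s := fun s' => harmonic_eq_of_irreducible hP0 hP1 hirr hh' s' s
    simp [this, ← Finset.sum_mul, hπ1]
  have hle : L.range ≤ ℓ.ker := by
    rintro _ ⟨h, rfl⟩
    rw [LinearMap.mem_ker, hℓ]
    simp only [hL, mul_sub, Finset.sum_sub_distrib, sum_stationary_mul hstat, sub_self]
  have hsurj : Function.Surjective ℓ := fun c => ⟨fun _ => c, by
    rw [hℓ, ← Finset.sum_mul, hπ1, one_mul]⟩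
  have h1 := L.finrank_range_add_finrank_ker
  have h2 := ℓ.finrank_range_add_finrank_ker
  rw [LinearMap.range_eq_top.mpr hsurj, finrank_top, Module.finrank_self] at h2
  have h3 : Module.finrank ℝ L.ker ≤ 1 :=
    (Submodule.finrank_mono hker).trans ((finrank_span_le_card _).trans (by simp))
  have heq : L.range = ℓ.ker := Submodule.eq_of_le_of_finrank_le hle (by omega)
  have hmem : g ∈ L.range := by rw [heq, LinearMap.mem_ker, hℓ, hg]
  obtain ⟨h, hh⟩ := hmem
  exact ⟨h, fun s => by rw [← hL, hh]⟩

/-- If the expectations of `g` along an irreducible chain are bounded above by a geometric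
sequence tending to `0`, then the stationary expectation of `g` is nonpositive. -/
theorem sum_stationary_mul_nonpos [DecidableEq S] {P : S → S → ℝ}
    (hP0 : ∀ s s', 0 ≤ P s s') (hP1 : ∀ s, ∑ s', P s s' = 1)
    (hirr : ∀ s s', ∃ t : ℕ, 0 < evolve P (dirac s) t s')
    {π : S → ℝ} (hπ1 : ∑ s, π s = 1) (hstat : ∀ s', ∑ s, π s * P s s' = π s')
    {μ : S → ℝ} (hμ0 : ∀ s, 0 ≤ μ s) (hμ1 : ∑ s, μ s = 1) {g : S → ℝ} {q C : ℝ}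
    (hq0 : 0 ≤ q) (hq1 : q < 1) (hg : ∀ t, ∑ s, evolve P μ t s * g s ≤ C * q ^ t) :
    ∑ s, π s * g s ≤ 0 := by
  set c := ∑ s, π s * g s with hc
  obtain ⟨h, hh⟩ := exists_poisson_solution hP0 hP1 hirr hπ1 hstat (g := fun s => g s - c)
    (by simp only [mul_sub, Finset.sum_sub_distrib, ← Finset.sum_mul, hπ1, ← hc]; ring)
  have hstep : ∀ t, ∑ s, evolve P μ t s * g s
      = c + (∑ s, evolve P μ t s * h s - ∑ s, evolve P μ (t + 1) s * h s) := fun t => by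
    rw [sum_evolve_succ_mul, ← Finset.sum_sub_distrib]
    simp only [← mul_sub, hh]
    simp only [mul_sub, Finset.sum_sub_distrib, ← Finset.sum_mul, sum_evolve hP1 hμ1]
    ring
  have hsum : ∀ T : ℕ, T * c ≤ |C| * (1 - q)⁻¹
      + (∑ s, evolve P μ T s * h s - ∑ s, μ s * h s) := fun T => by
    have h1 : ∑ t ∈ Finset.range T, ∑ s, evolve P μ t s * g s
        = T * c + (∑ s, μ s * h s - ∑ s, evolve P μ T s * h s) := by
      simp only [hstep, Finset.sum_add_distrib, Finset.sum_const, Finset.card_range,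
        nsmul_eq_mul]
      rw [Finset.sum_range_sub' (fun t => ∑ s, evolve P μ t s * h s)]
      rfl
    have h2 : ∑ t ∈ Finset.range T, ∑ s, evolve P μ t s * g s ≤ |C| * (1 - q)⁻¹ :=
      calc _ ≤ ∑ t ∈ Finset.range T, |C| * q ^ t := Finset.sum_le_sum fun t _ =>
            (hg t).trans (mul_le_mul_of_nonneg_right (le_abs_self C) (by positivity))
        _ = |C| * ∑ t ∈ Finset.range T, q ^ t := by rw [Finset.mul_sum]
        _ ≤ |C| * (1 - q)⁻¹ := mul_le_mul_of_nonneg_left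
            ((summable_geometric_of_lt_one hq0 hq1).sum_le_tsum _ (fun t _ => by positivity)
              |>.trans_eq (tsum_geometric_of_lt_one hq0 hq1)) (abs_nonneg C)
    linarith
  have hbdd : ∀ T, ∑ s, evolve P μ T s * h s ≤ ∑ s, |h s| := fun T =>
    Finset.sum_le_sum fun s hs => by
      have h0 := evolve_nonneg hP0 hμ0 T
      have h1 : evolve P μ T s ≤ 1 :=
        (Finset.single_le_sum (fun s _ => h0 s) hs).trans_eq (sum_evolve hP1 hμ1 T)
      nlinarith [h0 s, le_abs_self (h s), abs_nonneg (h s)]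
  by_contra! hpos
  obtain ⟨T, hT⟩ := exists_nat_gt
    ((|C| * (1 - q)⁻¹ + (∑ s, |h s| - ∑ s, μ s * h s)) / c)
  rw [div_lt_iff₀ hpos] at hT
  linarith [hsum T, hbdd T]

end Evolution

section Moments

variable {S : Type*} [Fintype S]

theorem sum_mul_sub_mean_sq {μ : S → ℝ} (hμ1 : ∑ s, μ s = 1) (f : S → ℝ) (c : ℝ) :
    ∑ s, μ s * (f s - c) ^ 2 = ∑ s, μ s * f s ^ 2 - (∑ s, μ s * f s) ^ 2
      + (∑ s, μ s * f s - c) ^ 2 := by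
  have h : ∑ s, μ s * (f s - c) ^ 2
      = ∑ s, μ s * f s ^ 2 - 2 * c * ∑ s, μ s * f s + c ^ 2 * ∑ s, μ s := by
    rw [Finset.mul_sum, Finset.mul_sum, ← Finset.sum_sub_distrib, ← Finset.sum_add_distrib]
    exact Finset.sum_congr rfl fun s _ => by ring
  rw [h, hμ1]; ring

theorem variance_nonneg_of_sum_eq_one {μ : S → ℝ} (hμ0 : ∀ s, 0 ≤ μ s) (hμ1 : ∑ s, μ s = 1)
    (f : S → ℝ) : 0 ≤ ∑ s, μ s * f s ^ 2 - (∑ s, μ s * f s) ^ 2 := by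
  have h := sum_mul_sub_mean_sq hμ1 f (∑ s, μ s * f s)
  rw [sub_self, zero_pow two_ne_zero, add_zero] at h
  rw [← h]
  exact Finset.sum_nonneg fun s _ => mul_nonneg (hμ0 s) (sq_nonneg _)

theorem sum_mul_linear_combination {ι : Type*} [Fintype ι] (μ : S → ℝ) (Φ : ι → S → ℝ)
    (a : ι → ℝ) : ∑ s, μ s * ∑ j, a j * Φ j s = ∑ j, a j * ∑ s, μ s * Φ j s := by
  simp only [Finset.mul_sum]
  rw [Finset.sum_comm]
  exact Finset.sum_congr rfl fun _ _ => Finset.sum_congr rfl fun _ _ => by ring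

theorem variance_linear_combination {ι : Type*} [Fintype ι] (μ : S → ℝ) (Φ : ι → S → ℝ)
    (a : ι → ℝ) :
    ∑ s, μ s * (∑ j, a j * Φ j s) ^ 2 - (∑ s, μ s * ∑ j, a j * Φ j s) ^ 2
      = ∑ j, ∑ k, a j * a k * ((∑ s, μ s * (Φ j s * Φ k s))
        - (∑ s, μ s * Φ j s) * (∑ s, μ s * Φ k s)) := by
  have h1 : ∑ s, μ s * (∑ j, a j * Φ j s) ^ 2
      = ∑ j, ∑ k, a j * a k * ∑ s, μ s * (Φ j s * Φ k s) := by
    simp only [pow_two, Finset.sum_mul_sum]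
    simp only [Finset.mul_sum]
    rw [Finset.sum_comm]
    refine Finset.sum_congr rfl fun j _ => ?_
    rw [Finset.sum_comm]
    exact Finset.sum_congr rfl fun _ _ => Finset.sum_congr rfl fun _ _ => by ring
  rw [h1, sum_mul_linear_combination, sq, Finset.sum_mul_sum, ← Finset.sum_sub_distrib]
  refine Finset.sum_congr rfl fun j _ => ?_
  rw [← Finset.sum_sub_distrib]
  exact Finset.sum_congr rfl fun k _ => by ring

/-- For negatively correlated functions of variance at most `v`, a linear combination with
coefficients of arbitrary signs has variance at most `2 v` times the sum of squares. -/
theorem variance_linear_combination_le {ι : Type*} [Fintype ι] {μ : S → ℝ}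
    (hμ0 : ∀ s, 0 ≤ μ s) (hμ1 : ∑ s, μ s = 1) {Φ : ι → S → ℝ} {v : ℝ}
    (hvar : ∀ j, ∑ s, μ s * Φ j s ^ 2 - (∑ s, μ s * Φ j s) ^ 2 ≤ v)
    (hcov : ∀ j k, j ≠ k → (∑ s, μ s * (Φ j s * Φ k s))
      - (∑ s, μ s * Φ j s) * (∑ s, μ s * Φ k s) ≤ 0) (a : ι → ℝ) :
    ∑ s, μ s * (∑ j, a j * Φ j s) ^ 2 - (∑ s, μ s * ∑ j, a j * Φ j s) ^ 2
      ≤ 2 * v * ∑ j, a j ^ 2 := by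
  classical
  have h0 := variance_nonneg_of_sum_eq_one hμ0 hμ1 (fun s => ∑ j, |a j| * Φ j s)
  rw [variance_linear_combination] at h0 ⊢
  refine (le_add_of_nonneg_right h0).trans ?_
  rw [← Finset.sum_add_distrib, Finset.mul_sum]
  refine Finset.sum_le_sum fun j _ => ?_
  rw [← Finset.sum_add_distrib]
  calc _ ≤ ∑ k, if j = k then 2 * v * a j ^ 2 else 0 := Finset.sum_le_sum fun k _ => ?_
    _ = _ := by simp
  split_ifs with hjk
  · subst hjk
    have := hvar j
    simp only [sq] at this
    rw [abs_mul_abs_self]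
    nlinarith [mul_self_nonneg (a j)]
  · have h1 : 0 ≤ a j * a k + |a j| * |a k| := by
      rw [← abs_mul]; linarith [neg_abs_le (a j * a k)]
    rw [← add_mul]
    exact mul_nonpos_of_nonneg_of_nonpos h1 (hcov j k hjk)

/-- Second-moment lower bound on the total variation distance. -/
theorem sq_le_tvDist_mul {μ ν : S → ℝ} (hμ0 : ∀ s, 0 ≤ μ s) (hμ1 : ∑ s, μ s = 1)
    (hν0 : ∀ s, 0 ≤ ν s) (hν1 : ∑ s, ν s = 1) {f : S → ℝ}
    {v : ℝ} (hμv : ∑ s, μ s * f s ^ 2 - (∑ s, μ s * f s) ^ 2 ≤ v)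
    (hνv : ∑ s, ν s * f s ^ 2 - (∑ s, ν s * f s) ^ 2 ≤ v) :
    (∑ s, μ s * f s - ∑ s, ν s * f s) ^ 2
      ≤ tvDist μ ν * (4 * v + (∑ s, μ s * f s - ∑ s, ν s * f s) ^ 2) := by
  set A := ∑ s, μ s * f s with hA
  set B := ∑ s, ν s * f s with hB
  let c := (A + B) / 2
  have h1 : A - B = ∑ s, (μ s - ν s) * (f s - c) := by
    simp only [sub_mul, mul_sub, Finset.sum_sub_distrib, ← Finset.sum_mul, hμ1, hν1, ← hA, ← hB]
    ring
  have h2 : (A - B) ^ 2 ≤ (∑ s, |μ s - ν s|) * ∑ s, |μ s - ν s| * (f s - c) ^ 2 := by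
    rw [h1]
    refine Finset.sum_sq_le_sum_mul_sum_of_sq_le_mul _ (fun s _ => abs_nonneg _)
      (fun s _ => by positivity) fun s _ => ?_
    rw [mul_pow, ← sq_abs (μ s - ν s), sq |μ s - ν s|, mul_assoc]
  have h3 : ∑ s, |μ s - ν s| * (f s - c) ^ 2
      ≤ ∑ s, μ s * (f s - c) ^ 2 + ∑ s, ν s * (f s - c) ^ 2 := by
    rw [← Finset.sum_add_distrib]
    refine Finset.sum_le_sum fun s _ => ?_
    rw [← add_mul]
    refine mul_le_mul_of_nonneg_right (abs_le.mpr ⟨?_, ?_⟩) (sq_nonneg _) <;>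
      linarith [hμ0 s, hν0 s]
  have h4 : ∑ s, |μ s - ν s| * (f s - c) ^ 2 ≤ 2 * v + (A - B) ^ 2 / 2 := by
    rw [sum_mul_sub_mean_sq hμ1, sum_mul_sub_mean_sq hν1, ← hA, ← hB] at h3
    have : (A - c) ^ 2 + (B - c) ^ 2 = (A - B) ^ 2 / 2 := by simp only [c]; ring
    linarith
  refine h2.trans ((mul_le_mul_of_nonneg_left h4
    (Finset.sum_nonneg fun s _ => abs_nonneg _)).trans_eq ?_)
  unfold tvDist; ring

end Moments

/-- Extension of Wilson's lemma using several eigenvectors (Section 3.2). -/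
theorem wilson_multi_eigenvector {S : Type*} [Fintype S] [DecidableEq S]
    (P : S → S → ℝ) (hP0 : ∀ s s', 0 ≤ P s s') (hP1 : ∀ s, ∑ s', P s s' = 1)
    -- irreducibility and aperiodicity
    (hirr : ∀ s s', ∃ t : ℕ, 0 < evolve P (dirac s) t s')
    (haper : ∀ s : S, ∃ t0 : ℕ, ∀ t ≥ t0, 0 < evolve P (dirac s) t s)
    (π : S → ℝ) (hπ0 : ∀ s, 0 ≤ π s) (hπ1 : ∑ s, π s = 1)
    (hstat : ∀ s', ∑ s, π s * P s s' = π s')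
    (s0 : S) (m : ℕ) (Φ : Fin m → S → ℝ) (γ : Fin m → ℝ)
    (hγ : ∀ j, γ j ∈ Set.Ioc (0 : ℝ) (1/2))
    (heig : ∀ j s, ∑ s', P s s' * Φ j s' = (1 - γ j) * Φ j s)
    (hvar : ∀ j s, ∑ s', P s s' * (Φ j s' - Φ j s) ^ 2 ≤ γ j)
    (hcov : ∀ j k, j ≠ k → ∀ t : ℕ,
      (∑ s, evolve P (dirac s0) t s * (Φ j s * Φ k s))
        - (∑ s, evolve P (dirac s0) t s * Φ j s) * (∑ s, evolve P (dirac s0) t s * Φ k s)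
        ≤ 0)
    (a : Fin m → ℝ) (ha : ∑ j, a j ^ 2 = 1)
    (t : ℕ) (ht : Real.sqrt 6 ≤ |∑ j, a j * (1 - γ j) ^ t * Φ j s0|) :
    1/3 ≤ tvDist (evolve P (dirac s0) t) π := by
  have hμ0 := evolve_nonneg hP0 (dirac_nonneg s0) t
  have hμ1 := sum_evolve hP1 (sum_dirac s0) t
  have hmean : ∀ j t, ∑ s, evolve P (dirac s0) t s * Φ j s = (1 - γ j) ^ t * Φ j s0 :=
    fun j t => by rw [sum_evolve_mul_eigenvector _ (heig j), sum_dirac_mul]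
  have hπmean : ∀ j, ∑ s, π s * Φ j s = 0 := fun j =>
    sum_stationary_mul_eigenvector hstat (hγ j).1.ne' (heig j)
  have hμvar := variance_linear_combination_le hμ0 hμ1 (v := 1 / 2)
    (fun j => variance_evolve_le_half hP0 hP1 (dirac_nonneg s0) (sum_dirac s0) (hγ j).2
      (heig j) (hvar j) (by simp [sum_dirac_mul]) t)
    (fun j k hjk => hcov j k hjk t) a
  have hπvar := variance_linear_combination_le hπ0 hπ1 (Φ := Φ) (v := 1 / 2)
    (fun j => by
      simpa [hπmean] using
        sum_stationary_mul_sq_le_half hP0 hP1 hπ0 hπ1 hstat (hγ j).1 (heig j) (hvar j))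
    (fun j k hjk => by
      rw [hπmean, zero_mul, sub_zero]
      obtain ⟨hj0, hj1⟩ := hγ j
      obtain ⟨hk0, hk1⟩ := hγ k
      refine sum_stationary_mul_nonpos hP0 hP1 hirr hπ1 hstat (dirac_nonneg s0) (sum_dirac s0)
        (q := (1 - γ j) * (1 - γ k)) (C := Φ j s0 * Φ k s0)
        (mul_nonneg (by linarith) (by linarith)) (by nlinarith) fun n => ?_
      have := hcov j k hjk n
      rw [hmean, hmean] at this
      rw [mul_pow]
      linarith) a
  rw [ha] at hμvar hπvar
  have key := sq_le_tvDist_mul hμ0 hμ1 hπ0 hπ1 hμvar hπvar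
  simp only [sum_mul_linear_combination, hmean, hπmean, mul_zero, Finset.sum_const_zero,
    sub_zero, ← mul_assoc] at key
  have hsq : 6 ≤ (∑ j, a j * (1 - γ j) ^ t * Φ j s0) ^ 2 := by
    rw [← sq_abs]
    exact (Real.sqrt_le_left (abs_nonneg _)).mp ht
  by_contra! hlt
  nlinarith
end
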